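/- Let C be a covering of a finite set E such that the family {N(x) : x ∈ E} forms a partition of E. Then XH(X) = VH(X) for every X ⊆ E. -/

import Mathlib

variable {α : Type*}

/-- `C` is a covering of the (finite) universe: a finite family of nonempty
subsets whose union is everything. -/
def IsCovering [Fintype α] (C : Finset (Set α)) : Prop :=
  (∀ K ∈ C, K.Nonempty) ∧ ⋃₀ (C : Set (Set α)) = Set.univ

/-- The neighborhood of `x`: `N(x) = ⋂ {K ∈ C : x ∈ K}`. -/
def nbhd (C : Finset (Set α)) (x : α) : Set α :=
  ⋂₀ {K | K ∈ C ∧ x ∈ K}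

/-- The sixth covering upper approximation operator:
`XH(X) = {x : N(x) ∩ X ≠ ∅}`. -/
def XH (C : Finset (Set α)) (X : Set α) : Set α :=
  {x | (nbhd C x ∩ X).Nonempty}

/-- The seventh covering upper approximation operator:
`VH(X) = ⋃ {N(y) : y ∈ E, N(y) ∩ X ≠ ∅}`. -/
def VH (C : Finset (Set α)) (X : Set α) : Set α :=
  ⋃₀ {S | ∃ y : α, S = nbhd C y ∧ (nbhd C y ∩ X).Nonempty}

theorem mem_nbhd_self (C : Finset (Set α)) (x : α) : x ∈ nbhd C x :=
  fun _ hK => hK.2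

/-- for a covering `C` of a finite set `E` such that
`{N(x) : x ∈ E}` forms a partition of `E`, `XH(X) = VH(X)` for every
`X ⊆ E`. -/
theorem stmt18 [Fintype α] (C : Finset (Set α)) (hC : IsCovering C)
    (hpart : ∀ x y : α, nbhd C x = nbhd C y ∨ nbhd C x ∩ nbhd C y = ∅) :
    ∀ X : Set α, XH C X = VH C X := by
  intro X
  ext x
  constructor
  · intro hx
    exact ⟨nbhd C x, ⟨x, rfl, hx⟩, mem_nbhd_self C x⟩
  · rintro ⟨_, ⟨y, rfl, hy⟩, hxy⟩
    rcases hpart x y with h | h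
    · exact (congrArg (fun S => (S ∩ X).Nonempty) h).mpr hy
    · exact absurd h (Set.Nonempty.ne_empty ⟨x, mem_nbhd_self C x, hxy⟩)
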